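/- Let G(q)=1/((q,q^4;q^5)_∞) and H(q)=1/((q^2,q^3;q^5)_∞), E(q)=(q;q)_∞. Then G(q)^2 H(q^2) - G(q^2) H(q)^2 = 2q H(q) H(q^2)^2 E(q^{10})^2/E(q^5)^2. -/

import Mathlib

/-- Euler's product E(q) = ∏_{k≥0} (1 - q^{k+1}). -/
noncomputable def E (q : ℂ) : ℂ := ∏' k : ℕ, (1 - q ^ (k + 1))

/-- q-Pochhammer infinite product (a;q)_∞ = ∏_{k≥0} (1 - a q^k). -/
noncomputable def qp (a q : ℂ) : ℂ := ∏' k : ℕ, (1 - a * q ^ k)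

/-- Rogers–Ramanujan function G(q) = 1/((q,q^4;q^5)_∞). -/
noncomputable def G (q : ℂ) : ℂ := 1 / (qp q (q ^ 5) * qp (q ^ 4) (q ^ 5))

/-- Rogers–Ramanujan function H(q) = 1/((q^2,q^3;q^5)_∞). -/
noncomputable def H (q : ℂ) : ℂ := 1 / (qp (q ^ 2) (q ^ 5) * qp (q ^ 3) (q ^ 5))

/-- Rogers–Ramanujan continued fraction product R(q). -/
noncomputable def R (q : ℂ) : ℂ :=
  (qp q (q ^ 5) * qp (q ^ 4) (q ^ 5)) / (qp (q ^ 2) (q ^ 5) * qp (q ^ 3) (q ^ 5))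

open Filter Topology

/-- The two-sided theta series `∑ s ^ (k ^ 2) y ^ k` over the integers. -/
noncomputable def thetaSeries (s y : ℂ) : ℂ := ∑' k : ℤ, s ^ (k ^ 2) * y ^ k

/-- The reciprocal of the finite product `(p; p)_m`, extended by zero to negative `m`. -/
noncomputable def recipPoch (p : ℂ) (m : ℤ) : ℂ :=
  if m < 0 then 0 else (∏ i ∈ Finset.range m.toNat, (1 - p ^ (i + 1)))⁻¹

lemma one_sub_ne_zero_of_norm_lt_one {z : ℂ} (hz : ‖z‖ < 1) : 1 - z ≠ 0 := by
  intro h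
  rw [← sub_eq_zero.mp h] at hz
  simp at hz

lemma norm_mul_pow_lt_one {z p : ℂ} (hz : ‖z‖ < 1) (hp : ‖p‖ < 1) (n : ℕ) :
    ‖z * p ^ n‖ < 1 := by
  rw [norm_mul, norm_pow]
  exact mul_lt_one_of_nonneg_of_lt_one_left (norm_nonneg _) hz
    (pow_le_one₀ (norm_nonneg _) hp.le)

lemma summable_norm_mul_pow (z : ℂ) {p : ℂ} (hp : ‖p‖ < 1) :
    Summable fun n : ℕ ↦ ‖-(z * p ^ n)‖ := by
  simp only [norm_neg, norm_mul, norm_pow]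
  exact (summable_geometric_of_lt_one (norm_nonneg _) hp).mul_left _

lemma multipliable_qp (z : ℂ) {p : ℂ} (hp : ‖p‖ < 1) :
    Multipliable fun n : ℕ ↦ 1 - z * p ^ n := by
  simpa only [sub_eq_add_neg] using multipliable_one_add_of_summable (summable_norm_mul_pow z hp)

lemma qp_ne_zero {z p : ℂ} (hz : ‖z‖ < 1) (hp : ‖p‖ < 1) : qp z p ≠ 0 := by
  have := tprod_one_add_ne_zero_of_summable (f := fun n : ℕ ↦ -(z * p ^ n))
    (fun n ↦ by
      rw [← sub_eq_add_neg]
      exact one_sub_ne_zero_of_norm_lt_one (norm_mul_pow_lt_one hz hp n))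
    (summable_norm_mul_pow z hp)
  simpa only [qp, ← sub_eq_add_neg] using this

lemma tendsto_qp (z : ℂ) {p : ℂ} (hp : ‖p‖ < 1) :
    Tendsto (fun n ↦ ∏ i ∈ Finset.range n, (1 - z * p ^ i)) atTop (𝓝 (qp z p)) :=
  (multipliable_qp z hp).tendsto_prod_tprod_nat

lemma E_eq_qp (q : ℂ) : E q = qp q q := by
  simp only [E, qp, pow_succ']

lemma qp_sq (z : ℂ) {p : ℂ} (hp : ‖p‖ < 1) : qp (z ^ 2) (p ^ 2) = qp z p * qp (-z) p := by
  rw [qp, qp, qp, ← (multipliable_qp z hp).tprod_mul (multipliable_qp (-z) hp)]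
  exact tprod_congr fun n ↦ by ring

lemma qp_eq_mul (z : ℂ) {p : ℂ} (hp : ‖p‖ < 1) : qp z p = (1 - z) * qp (z * p) p := by
  have h := tprod_eq_zero_mul' (f := fun n : ℕ ↦ 1 - z * p ^ n)
    (by simpa only [pow_succ', mul_assoc] using multipliable_qp (z * p) hp)
  simpa only [qp, pow_succ', mul_assoc, pow_zero, mul_one] using h

lemma recipPoch_natCast (p : ℂ) (m : ℕ) :
    recipPoch p m = (∏ i ∈ Finset.range m, (1 - p ^ (i + 1)))⁻¹ := by
  simp [recipPoch]

lemma recipPoch_sub_one {p : ℂ} (hp : ‖p‖ < 1) (m : ℤ) :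
    recipPoch p (m - 1) = (1 - p ^ m) * recipPoch p m := by
  rcases lt_trichotomy m 0 with h | rfl | h
  · simp [recipPoch, h, show m < 1 by lia]
  · simp [recipPoch]
  · obtain ⟨n, rfl⟩ : ∃ n : ℕ, m = n + 1 := ⟨(m - 1).toNat, by lia⟩
    have h1 : 1 - p ^ (n + 1) ≠ 0 := by
      have := norm_mul_pow_lt_one hp hp n
      rw [← pow_succ'] at this
      exact one_sub_ne_zero_of_norm_lt_one this
    have h2 := recipPoch_natCast p (n + 1)
    push_cast at h2
    rw [add_sub_cancel_right, h2, recipPoch_natCast, Finset.prod_range_succ, mul_inv]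
    have h3 : p ^ ((n : ℤ) + 1) = p ^ (n + 1) := by norm_cast
    rw [h3]
    field_simp

lemma tendsto_recipPoch {p : ℂ} (hp : ‖p‖ < 1) :
    Tendsto (recipPoch p) atTop (𝓝 (qp p p)⁻¹) := by
  have h := (tendsto_qp p hp).inv₀ (qp_ne_zero hp hp)
  have ht : Tendsto Int.toNat atTop atTop :=
    tendsto_atTop_atTop.mpr fun b ↦ ⟨b, fun a ha ↦ by lia⟩
  refine (h.comp ht).congr' ?_
  filter_upwards [eventually_ge_atTop 0] with m hm
  simp [recipPoch, hm.not_gt, pow_succ']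

lemma exists_norm_recipPoch_le {p : ℂ} (hp : ‖p‖ < 1) : ∃ M, ∀ m, ‖recipPoch p m‖ ≤ M := by
  obtain ⟨M, hM⟩ := (Metric.isBounded_range_of_tendsto _
    ((tendsto_recipPoch hp).comp tendsto_natCast_atTop_atTop)).exists_norm_le
  refine ⟨M, fun m ↦ ?_⟩
  rcases lt_or_ge m 0 with h | h
  · simpa [recipPoch, h] using (norm_nonneg _).trans (hM _ ⟨0, rfl⟩)
  · lift m to ℕ using h
    exact hM _ ⟨m, rfl⟩

lemma summable_norm_theta_nat {s y : ℂ} (hs0 : s ≠ 0) (hs : ‖s‖ < 1) (hy : y ≠ 0) :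
    Summable fun n : ℕ ↦ ‖s ^ (n ^ 2) * y ^ n‖ := by
  refine summable_of_ratio_test_tendsto_lt_one (l := 0) zero_lt_one
    (Eventually.of_forall fun n ↦ by simp [hs0, hy]) ?_
  have h : Tendsto (fun n : ℕ ↦ ‖s * y‖ * (‖s‖ ^ 2) ^ n) atTop (𝓝 (‖s * y‖ * 0)) :=
    (tendsto_pow_atTop_nhds_zero_of_lt_one (by positivity)
      (pow_lt_one₀ (norm_nonneg _) hs two_ne_zero)).const_mul _
  rw [mul_zero] at h
  refine h.congr fun n ↦ ?_
  have hs0' := norm_ne_zero_iff.mpr hs0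
  have hy' := norm_ne_zero_iff.mpr hy
  simp only [norm_mul, norm_pow, norm_norm]
  field_simp
  ring

lemma summable_norm_theta {s y : ℂ} (hs0 : s ≠ 0) (hs : ‖s‖ < 1) (hy : y ≠ 0) :
    Summable fun k : ℤ ↦ ‖s ^ (k ^ 2) * y ^ k‖ := by
  refine Summable.of_nat_of_neg ?_ ?_
  · exact_mod_cast summable_norm_theta_nat hs0 hs hy
  · refine (summable_norm_theta_nat hs0 hs (inv_ne_zero hy)).congr fun n ↦ ?_
    rw [neg_sq, zpow_neg, inv_pow]
    norm_cast

/-- Coefficients of the finite Jacobi triple product. -/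
noncomputable def tripleCoeff (s : ℂ) (n : ℕ) (k : ℤ) : ℂ :=
  (∏ i ∈ Finset.range (2 * n), (1 - (s ^ 2) ^ (i + 1))) * recipPoch (s ^ 2) (n - k) *
    recipPoch (s ^ 2) (n + k) * s ^ (k ^ 2)

lemma norm_sq_lt_one {s : ℂ} (hs : ‖s‖ < 1) : ‖s ^ 2‖ < 1 := by
  rw [norm_pow]
  exact pow_lt_one₀ (norm_nonneg _) hs two_ne_zero

lemma tripleCoeff_succ {s : ℂ} (hs0 : s ≠ 0) (hs : ‖s‖ < 1) (n : ℕ) (k : ℤ) :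
    tripleCoeff s (n + 1) k = (1 + s ^ (4 * n + 2)) * tripleCoeff s n k +
      s ^ (2 * n + 1) * tripleCoeff s n (k - 1) + s ^ (2 * n + 1) * tripleCoeff s n (k + 1) := by
  have hp := norm_sq_lt_one hs
  have hp0 : s ^ 2 ≠ 0 := pow_ne_zero 2 hs0
  have e1 := recipPoch_sub_one hp (n + 1 - k)
  have e2 := recipPoch_sub_one hp (n + 1 + k)
  have e3 := recipPoch_sub_one hp (n - k)
  have e4 := recipPoch_sub_one hp (n + k)
  rw [show (n + 1 - k - 1 : ℤ) = n - k by ring] at e1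
  rw [show (n + 1 + k - 1 : ℤ) = n + k by ring] at e2
  rw [e1] at e3
  rw [e2] at e4
  simp only [tripleCoeff]
  push_cast
  rw [show (n - (k - 1) : ℤ) = n + 1 - k by ring, show (n + (k - 1) : ℤ) = n + k - 1 by ring,
    show (n - (k + 1) : ℤ) = n - k - 1 by ring, show (n + (k + 1) : ℤ) = n + 1 + k by ring,
    e1, e2, e3, e4, show 2 * (n + 1) = 2 * n + 1 + 1 by ring, Finset.prod_range_succ,
    Finset.prod_range_succ, show (k - 1) ^ 2 = k ^ 2 - k - k + 1 by ring,
    show (k + 1) ^ 2 = k ^ 2 + k + k + 1 by ring]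
  simp only [zpow_add₀ hs0, zpow_sub₀ hs0, zpow_add₀ hp0, zpow_sub₀ hp0, zpow_one, zpow_natCast]
  have ek : (s ^ 2) ^ k = s ^ k * s ^ k := by
    rw [sq, mul_zpow]
  rw [ek]
  have hk : s ^ k ≠ 0 := zpow_ne_zero k hs0
  generalize s ^ (k ^ 2) = S
  generalize s ^ k = w at *
  generalize recipPoch (s ^ 2) (n + 1 - k) = a
  generalize recipPoch (s ^ 2) (n + 1 + k) = b
  generalize ∏ x ∈ Finset.range (2 * n), (1 - (s ^ 2) ^ (x + 1)) = P
  field_simp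
  ring

lemma hasSum_tripleCoeff {s y : ℂ} (hs0 : s ≠ 0) (hs : ‖s‖ < 1) (hy : y ≠ 0) (n : ℕ) :
    HasSum (fun k : ℤ ↦ tripleCoeff s n k * y ^ k)
      (∏ i ∈ Finset.range n, ((1 + y * s * (s ^ 2) ^ i) * (1 + s / y * (s ^ 2) ^ i))) := by
  induction n with
  | zero =>
    convert hasSum_single (0 : ℤ) fun k hk ↦ ?_ using 1
    · simp [tripleCoeff, recipPoch]
    · rcases lt_or_gt_of_ne hk with h | h <;> simp [tripleCoeff, recipPoch, h]
  | succ n ih =>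
    have h1 := (Equiv.addRight (-1 : ℤ)).hasSum_iff.mpr ih
    have h2 := (Equiv.addRight (1 : ℤ)).hasSum_iff.mpr ih
    have h := ((ih.mul_left (1 + s ^ (4 * n + 2))).add (h1.mul_left (s ^ (2 * n + 1) * y))).add
      (h2.mul_left (s ^ (2 * n + 1) / y))
    refine (congrArg₂ (fun f a ↦ HasSum f a) (funext fun k ↦ ?_) ?_).mpr h
    · simp only [Function.comp_apply, Equiv.coe_addRight, tripleCoeff_succ hs0 hs,
        ← sub_eq_add_neg, zpow_add₀ hy, zpow_sub₀ hy, zpow_one]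
      field_simp
    · rw [Finset.prod_range_succ]
      field_simp
      ring

/-- The Jacobi triple product identity. -/
lemma qp_mul_qp_eq_thetaSeries {s y : ℂ} (hs0 : s ≠ 0) (hs : ‖s‖ < 1) (hy : y ≠ 0) :
    qp (-(y * s)) (s ^ 2) * qp (-(s / y)) (s ^ 2) =
      (qp (s ^ 2) (s ^ 2))⁻¹ * thetaSeries s y := by
  have hp := norm_sq_lt_one hs
  have hP : Tendsto (fun n : ℕ ↦ ∏ i ∈ Finset.range (2 * n), (1 - (s ^ 2) ^ (i + 1))) atTop
      (𝓝 (qp (s ^ 2) (s ^ 2))) := by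
    have := (tendsto_qp (s ^ 2) hp).comp (tendsto_id.const_mul_atTop' (zero_lt_two' ℕ))
    simpa only [Function.comp_def, id, ← pow_succ'] using this
  obtain ⟨M, hM⟩ := (Metric.isBounded_range_of_tendsto _ hP).exists_norm_le
  obtain ⟨N, hN⟩ := exists_norm_recipPoch_le hp
  have hM0 : 0 ≤ M := (norm_nonneg _).trans (hM _ ⟨0, rfl⟩)
  have hN0 : 0 ≤ N := (norm_nonneg _).trans (hN 0)
  have hlim : Tendsto (fun n ↦ ∑' k : ℤ, tripleCoeff s n k * y ^ k) atTop
      (𝓝 (∑' k : ℤ, (qp (s ^ 2) (s ^ 2))⁻¹ * (s ^ (k ^ 2) * y ^ k))) := by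
    refine tendsto_tsum_of_dominated_convergence
      ((summable_norm_theta hs0 hs hy).mul_left (M * N * N)) (fun k ↦ ?_)
      (Eventually.of_forall fun n k ↦ ?_)
    · have hr := tendsto_recipPoch hp
      have h1 := hr.comp ((tendsto_natCast_atTop_atTop (R := ℤ)).atTop_add
        (tendsto_const_nhds (x := -k)))
      have h2 := hr.comp ((tendsto_natCast_atTop_atTop (R := ℤ)).atTop_add
        (tendsto_const_nhds (x := k)))
      have h := (((hP.mul h1).mul h2).mul_const (s ^ (k ^ 2))).mul_const (y ^ k)
      rw [mul_inv_cancel₀ (qp_ne_zero hp hp), one_mul, mul_assoc] at h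
      simpa only [tripleCoeff, Function.comp_def, ← sub_eq_add_neg] using h
    · rw [tripleCoeff, mul_assoc _ (s ^ (k ^ 2)), norm_mul, norm_mul, norm_mul]
      have := hM _ ⟨n, rfl⟩
      have := hN (n - k)
      have := hN (n + k)
      gcongr
  have hprod := (tendsto_qp (-(y * s)) hp).mul (tendsto_qp (-(s / y)) hp)
  rw [thetaSeries, ← tsum_mul_left]
  refine tendsto_nhds_unique (hprod.congr fun n ↦ ?_) hlim
  rw [(hasSum_tripleCoeff hs0 hs hy n).tsum_eq, ← Finset.prod_mul_distrib]
  exact Finset.prod_congr rfl fun i _ ↦ by ring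

/-- Pairs of integers, split according to the parity of their sum. -/
noncomputable def intProdParityEquiv : (ℤ × ℤ) ⊕ (ℤ × ℤ) ≃ ℤ × ℤ :=
  Equiv.ofBijective
    (Sum.elim (fun z ↦ (z.1 + z.2, z.1 - z.2)) fun z ↦ (z.1 + z.2 + 1, z.1 - z.2)) <| by
    constructor
    · rintro (⟨a, b⟩ | ⟨a, b⟩) (⟨c, d⟩ | ⟨c, d⟩) h <;>
        simp only [Sum.elim_inl, Sum.elim_inr, Prod.mk.injEq, Sum.inl.injEq, Sum.inr.injEq,
          reduceCtorEq] at h ⊢ <;> lia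
    · rintro ⟨m, n⟩
      rcases Int.even_or_odd' (m + n) with ⟨k, h | h⟩
      · exact ⟨Sum.inl (k, m - k), by simp; lia⟩
      · exact ⟨Sum.inr (k, m - k - 1), by simp; lia⟩

lemma intProdParityEquiv_inl (k l : ℤ) :
    intProdParityEquiv (Sum.inl (k, l)) = (k + l, k - l) := rfl

lemma intProdParityEquiv_inr (k l : ℤ) :
    intProdParityEquiv (Sum.inr (k, l)) = (k + l + 1, k - l) := rfl

lemma thetaSeries_shift {s y : ℂ} (hs0 : s ≠ 0) (hy : y ≠ 0) :
    thetaSeries s y = s * y * thetaSeries s (s ^ 2 * y) := by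
  rw [thetaSeries, thetaSeries, ← (Equiv.addRight (1 : ℤ)).tsum_eq, ← tsum_mul_left]
  refine tsum_congr fun k ↦ ?_
  rw [Equiv.coe_addRight, show (k + 1) ^ 2 = k ^ 2 + k + k + 1 by ring, mul_zpow, sq s, mul_zpow]
  simp only [zpow_add₀ hs0, zpow_add₀ hy, zpow_one]
  ring

lemma thetaSeries_mul_thetaSeries {s a b : ℂ} (hs0 : s ≠ 0) (hs : ‖s‖ < 1) (ha : a ≠ 0)
    (hb : b ≠ 0) :
    thetaSeries s (a * b) * thetaSeries s (a / b) =
      thetaSeries (s ^ 2) (a ^ 2) * thetaSeries (s ^ 2) (b ^ 2) +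
        s * a * b * thetaSeries (s ^ 2) (s ^ 2 * a ^ 2) *
          thetaSeries (s ^ 2) (s ^ 2 * b ^ 2) := by
  have hp := norm_sq_lt_one hs
  have hp0 : s ^ 2 ≠ 0 := pow_ne_zero 2 hs0
  have hsum {t u v : ℂ} (ht0 : t ≠ 0) (ht : ‖t‖ < 1) (hu : u ≠ 0) (hv : v ≠ 0) :
      HasSum (fun z : ℤ × ℤ ↦ t ^ (z.1 ^ 2) * u ^ z.1 * (t ^ (z.2 ^ 2) * v ^ z.2))
        (thetaSeries t u * thetaSeries t v) := by
    have hu' := summable_norm_theta ht0 ht hu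
    have hv' := summable_norm_theta ht0 ht hv
    rw [thetaSeries, thetaSeries, tsum_mul_tsum_of_summable_norm hu' hv']
    exact (summable_mul_of_summable_norm hu' hv').hasSum
  have h := intProdParityEquiv.hasSum_iff.mpr
    (hsum hs0 hs (mul_ne_zero ha hb) (div_ne_zero ha hb))
  have h1 := hsum hp0 hp (pow_ne_zero 2 ha) (pow_ne_zero 2 hb)
  have h2 := (hsum hp0 hp (mul_ne_zero hp0 (pow_ne_zero 2 ha))
    (mul_ne_zero hp0 (pow_ne_zero 2 hb))).mul_left (s * a * b)
  rw [mul_assoc (s * a * b)]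
  refine h.unique (HasSum.sum ?_ ?_)
  · refine (congrArg (fun f ↦ HasSum f _) (funext fun ⟨k, l⟩ ↦ ?_)).mpr h1
    simp only [Function.comp_apply, intProdParityEquiv_inl]
    rw [show (k + l) ^ 2 = k ^ 2 + l ^ 2 + k * l + k * l by ring,
      show (k - l) ^ 2 = k ^ 2 + l ^ 2 - k * l - k * l by ring]
    simp only [zpow_add₀ hs0, zpow_sub₀ hs0, zpow_add₀, zpow_sub₀, mul_zpow, div_zpow, sq s, sq a,
      sq b, ha, hb, mul_ne_zero, div_ne_zero, ne_eq, not_false_eq_true]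
    have := zpow_ne_zero k ha
    have := zpow_ne_zero l ha
    have := zpow_ne_zero k hb
    have := zpow_ne_zero l hb
    have := zpow_ne_zero (k * l) hs0
    field_simp
  · refine (congrArg (fun f ↦ HasSum f _) (funext fun ⟨k, l⟩ ↦ ?_)).mpr h2
    simp only [Function.comp_apply, intProdParityEquiv_inr]
    rw [show (k + l + 1) ^ 2 = k ^ 2 + l ^ 2 + k * l + k * l + k + k + l + l + 1 by ring,
      show (k - l) ^ 2 = k ^ 2 + l ^ 2 - k * l - k * l by ring]
    simp only [zpow_add₀ hs0, zpow_sub₀ hs0, zpow_add₀, zpow_sub₀, mul_zpow, div_zpow, sq s, sq a,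
      sq b, ha, hb, mul_ne_zero, div_ne_zero, ne_eq, not_false_eq_true, zpow_one]
    have := zpow_ne_zero k ha
    have := zpow_ne_zero l ha
    have := zpow_ne_zero k hb
    have := zpow_ne_zero l hb
    have := zpow_ne_zero (k * l) hs0
    field_simp

/-- The theta product `(x; p)_∞ (p / x; p)_∞`. -/
noncomputable def thetaProd (p x : ℂ) : ℂ := qp x p * qp (p / x) p

lemma exists_thetaProd_mul_thetaProd {p : ℂ} (hp0 : p ≠ 0) (hp : ‖p‖ < 1) :
    ∃ b d : ℂ → ℂ, ∀ x y, x ≠ 0 → y ≠ 0 →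
      thetaProd p (x * y) * thetaProd p (x / y) = x * (d x * b y - b x * d y) := by
  obtain ⟨s, rfl⟩ := IsAlgClosed.exists_pow_nat_eq p zero_lt_two
  have hs0 : s ≠ 0 := by rintro rfl; simp at hp0
  have hs : ‖s‖ < 1 := by
    rw [norm_pow] at hp
    exact (sq_lt_one_iff₀ (norm_nonneg _)).mp hp
  have key : ∀ x, x ≠ 0 → thetaProd (s ^ 2) x =
      (qp (s ^ 2) (s ^ 2))⁻¹ * thetaSeries s (-(x / s)) := fun x hx ↦ by
    rw [← qp_mul_qp_eq_thetaSeries hs0 hs (neg_ne_zero.mpr (div_ne_zero hx hs0)), thetaProd]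
    congr 2 <;> field_simp
  refine ⟨fun x ↦ (qp (s ^ 2) (s ^ 2))⁻¹ * thetaSeries (s ^ 2) (x ^ 2),
    fun x ↦ (qp (s ^ 2) (s ^ 2))⁻¹ * (x * thetaSeries (s ^ 2) (s ^ 2 * x ^ 2)),
    fun x y hx hy ↦ ?_⟩
  have hxs : -(x / s) ≠ 0 := neg_ne_zero.mpr (div_ne_zero hx hs0)
  have h := thetaSeries_mul_thetaSeries hs0 hs hxs hy
  have hshift := thetaSeries_shift (pow_ne_zero 2 hs0) (pow_ne_zero 2 hxs)
  rw [show s ^ 2 * (-(x / s)) ^ 2 = x ^ 2 by field_simp,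
    show (s ^ 2) ^ 2 * (-(x / s)) ^ 2 = s ^ 2 * x ^ 2 by field_simp] at hshift
  rw [hshift, show s ^ 2 * (-(x / s)) ^ 2 = x ^ 2 by field_simp,
    show s * -(x / s) * y = -(x * y) by field_simp] at h
  rw [key _ (mul_ne_zero hx hy), key _ (div_ne_zero hx hy), show -(x * y / s) = -(x / s) * y by ring,
    show -(x / y / s) = -(x / s) / y by ring]
  linear_combination (qp (s ^ 2) (s ^ 2))⁻¹ ^ 2 * h

/-- The three-term theta relation. -/
lemma thetaProd_three_term {p : ℂ} (hp0 : p ≠ 0) (hp : ‖p‖ < 1) {x y u v : ℂ} (hx : x ≠ 0)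
    (hy : y ≠ 0) (hu : u ≠ 0) (hv : v ≠ 0) :
    y * (thetaProd p (x * y) * thetaProd p (x / y)) * (thetaProd p (u * v) * thetaProd p (u / v)) -
      y * (thetaProd p (x * v) * thetaProd p (x / v)) * (thetaProd p (u * y) * thetaProd p (u / y)) =
      u * (thetaProd p (x * u) * thetaProd p (x / u)) *
        (thetaProd p (y * v) * thetaProd p (y / v)) := by
  obtain ⟨b, d, h⟩ := exists_thetaProd_mul_thetaProd hp0 hp
  simp only [h, hx, hy, hu, hv, ne_eq, not_false_eq_true]
  ring

lemma thetaProd_div {p : ℂ} (hp0 : p ≠ 0) (x : ℂ) : thetaProd p (p / x) = thetaProd p x := by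
  rw [thetaProd, thetaProd, div_div_cancel₀ hp0, mul_comm]

lemma theta_relation_modulus_five {q : ℂ} (hq0 : q ≠ 0) (hq : ‖q‖ < 1) :
    thetaProd (q ^ 5) (-q) * thetaProd (q ^ 5) (q ^ 2) ^ 2 * thetaProd (q ^ 5) (-q ^ 2) -
      thetaProd (q ^ 5) q * thetaProd (q ^ 5) (q ^ 2) * thetaProd (q ^ 5) (-q ^ 2) ^ 2 =
      2 * q * qp (-q ^ 5) (q ^ 5) ^ 2 * thetaProd (q ^ 5) q ^ 2 * thetaProd (q ^ 5) (-q) := by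
  have hp0 : q ^ 5 ≠ 0 := pow_ne_zero 5 hq0
  have hp : ‖q ^ 5‖ < 1 := by
    rw [norm_pow]
    exact pow_lt_one₀ (norm_nonneg _) hq (by norm_num)
  have h := thetaProd_three_term hp0 hp (pow_ne_zero 3 hq0) hq0
    (neg_ne_zero.mpr (pow_ne_zero 2 hq0)) one_ne_zero
  have e4 : thetaProd (q ^ 5) (q ^ 3 * q) = thetaProd (q ^ 5) q := by
    rw [← thetaProd_div hp0 q]
    congr 1
    field_simp
  have e3 : thetaProd (q ^ 5) (q ^ 3) = thetaProd (q ^ 5) (q ^ 2) := by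
    rw [← thetaProd_div hp0 (q ^ 2)]
    congr 1
    field_simp
  have e3' : thetaProd (q ^ 5) (-q ^ 2 * q) = thetaProd (q ^ 5) (-q ^ 2) := by
    rw [← thetaProd_div hp0 (-q ^ 2)]
    congr 1
    field_simp
  have e5 : thetaProd (q ^ 5) (q ^ 3 * -q ^ 2) = 2 * qp (-q ^ 5) (q ^ 5) ^ 2 := by
    rw [thetaProd, show q ^ 3 * -q ^ 2 = -q ^ 5 by ring, div_neg, div_self hp0,
      qp_eq_mul (-1) hp, neg_one_mul]
    ring
  rw [e4, e3', e5, mul_one, mul_one, mul_one, div_one, div_one, div_one, e3,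
    show q ^ 3 / q = q ^ 2 by field_simp, show -q ^ 2 / q = -q by field_simp,
    show q ^ 3 / -q ^ 2 = -q by field_simp] at h
  refine mul_left_cancel₀ hq0 ?_
  linear_combination -h

theorem stmt_3 : ∀ q : ℂ, ‖q‖ < 1 →
    G q ^ 2 * H (q ^ 2) - G (q ^ 2) * H q ^ 2
      = 2 * q * H q * H (q ^ 2) ^ 2 * E (q ^ 10) ^ 2 / E (q ^ 5) ^ 2 := by
  intro q hq
  rcases eq_or_ne q 0 with rfl | hq0
  · simp [G, H, qp]
  have hpow : ∀ n : ℕ, n ≠ 0 → ‖q ^ n‖ < 1 := fun n hn ↦ by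
    rw [norm_pow]
    exact pow_lt_one₀ (norm_nonneg _) hq hn
  have hp := hpow 5 (by norm_num)
  have hj := theta_relation_modulus_five hq0 hq
  simp only [thetaProd] at hj
  rw [show q ^ 5 / -q = -q ^ 4 by field_simp, show q ^ 5 / q = q ^ 4 by field_simp,
    show q ^ 5 / -q ^ 2 = -q ^ 3 by field_simp, show q ^ 5 / q ^ 2 = q ^ 3 by field_simp] at hj
  have hsq : ∀ n : ℕ, qp ((q ^ 2) ^ n) ((q ^ 2) ^ 5) = qp (q ^ n) (q ^ 5) * qp (-q ^ n) (q ^ 5) :=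
    fun n ↦ by rw [← qp_sq _ hp, ← pow_mul, ← pow_mul, ← pow_mul, ← pow_mul, mul_comm 2 n]
  have hE : E (q ^ 10) = qp (q ^ 5) (q ^ 5) * qp (-q ^ 5) (q ^ 5) := by
    rw [E_eq_qp, ← qp_sq _ hp, ← pow_mul]
  have hsq1 : qp (q ^ 2) ((q ^ 2) ^ 5) = qp q (q ^ 5) * qp (-q) (q ^ 5) := by
    simpa using hsq 1
  have hne : ∀ n : ℕ, n ≠ 0 → qp (q ^ n) (q ^ 5) ≠ 0 := fun n hn ↦ qp_ne_zero (hpow n hn) hp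
  have hne' : ∀ n : ℕ, n ≠ 0 → qp (-q ^ n) (q ^ 5) ≠ 0 :=
    fun n hn ↦ qp_ne_zero (by simpa using hpow n hn) hp
  have n1 : qp q (q ^ 5) ≠ 0 := by simpa using hne 1 one_ne_zero
  have n1' : qp (-q) (q ^ 5) ≠ 0 := by simpa using hne' 1 one_ne_zero
  have n2 := hne 2 (by norm_num)
  have n2' := hne' 2 (by norm_num)
  have n3 := hne 3 (by norm_num)
  have n3' := hne' 3 (by norm_num)
  have n4 := hne 4 (by norm_num)
  have n4' := hne' 4 (by norm_num)
  have n5 := hne 5 (by norm_num)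
  rw [G, G, H, H, hE, E_eq_qp, hsq1, hsq 2, hsq 3, hsq 4]
  generalize qp q (q ^ 5) = a1 at *
  generalize qp (-q) (q ^ 5) = b1 at *
  generalize qp (q ^ 2) (q ^ 5) = a2 at *
  generalize qp (-q ^ 2) (q ^ 5) = b2 at *
  generalize qp (q ^ 3) (q ^ 5) = a3 at *
  generalize qp (-q ^ 3) (q ^ 5) = b3 at *
  generalize qp (q ^ 4) (q ^ 5) = a4 at *
  generalize qp (-q ^ 4) (q ^ 5) = b4 at *
  generalize qp (q ^ 5) (q ^ 5) = a5 at *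
  generalize qp (-q ^ 5) (q ^ 5) = b5 at *
  field_simp
  linear_combination hj
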